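/- For every β > 0, the functional J_{λ_{k+1}(V),β}(u) = (1/2)∫_V (|∇u|² − λ_{k+1}(V) u²) dμ − β log ∫_V h e^u dμ satisfies inf_{u ∈ E_k^⊥} J_{λ_{k+1}(V),β}(u) = −∞. -/

import Mathlib

open Finset

variable {V : Type*}

/-- Integral of `g` over `V` with respect to the measure `μ`. -/
noncomputable def intV [Fintype V] (μ g : V → ℝ) : ℝ := ∑ x, μ x * g x

/-- Volume of `V` with respect to the measure `μ`. -/
noncomputable def volV [Fintype V] (μ : V → ℝ) : ℝ := ∑ x, μ x

/-- The space `H` of functions with zero mean. -/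
def Hsp [Fintype V] (μ : V → ℝ) : Set (V → ℝ) := {u | intV μ u = 0}

/-- `|∇u|²(x)`, the squared length of the gradient of `u` at `x`. -/
noncomputable def gradSq [Fintype V] (G : SimpleGraph V) [DecidableRel G.Adj]
    (w : V → V → ℝ) (μ : V → ℝ) (u : V → ℝ) (x : V) : ℝ :=
  (1 / (2 * μ x)) * ∑ y, if G.Adj x y then w x y * (u y - u x) ^ 2 else 0

/-- The `μ`-Laplacian `Δu(x)`. -/
noncomputable def lapV [Fintype V] (G : SimpleGraph V) [DecidableRel G.Adj]
    (w : V → V → ℝ) (μ : V → ℝ) (u : V → ℝ) (x : V) : ℝ :=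
  (1 / μ x) * ∑ y, if G.Adj x y then w x y * (u y - u x) else 0

/-- The functional `J_β`. -/
noncomputable def Jb [Fintype V] (G : SimpleGraph V) [DecidableRel G.Adj]
    (w : V → V → ℝ) (μ h : V → ℝ) (β : ℝ) (u : V → ℝ) : ℝ :=
  (1 / 2) * intV μ (gradSq G w μ u)
    - β * Real.log (intV μ (fun x => h x * Real.exp (u x)))

/-- The functional `J_{α,β}`. -/
noncomputable def Jab [Fintype V] (G : SimpleGraph V) [DecidableRel G.Adj]
    (w : V → V → ℝ) (μ h : V → ℝ) (α β : ℝ) (u : V → ℝ) : ℝ :=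
  (1 / 2) * intV μ (fun x => gradSq G w μ u x - α * u x ^ 2)
    - β * Real.log (intV μ (fun x => h x * Real.exp (u x)))

/-- The first non-zero eigenvalue `λ₁(V)` of `-Δ`, defined variationally. -/
noncomputable def lam1V [Fintype V] (G : SimpleGraph V) [DecidableRel G.Adj]
    (w : V → V → ℝ) (μ : V → ℝ) : ℝ :=
  sInf ((fun u => intV μ (gradSq G w μ u)) ''
    {u | u ∈ Hsp μ ∧ intV μ (fun x => u x ^ 2) = 1})

/-- The eigenspace of `-Δ` with eigenvalue `c` (inside `H`). -/
def eigSp [Fintype V] (G : SimpleGraph V) [DecidableRel G.Adj]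
    (w : V → V → ℝ) (μ : V → ℝ) (c : ℝ) : Set (V → ℝ) :=
  {v | intV μ v = 0 ∧ ∀ x, -(lapV G w μ v x) = c * v x}

/-- `E_k^⊥`: functions in `H` orthogonal to the eigenspaces of the first `k`
distinct non-zero eigenvalues (`lam` lists the distinct non-zero eigenvalues,
0-indexed, so `lam ⟨s⟩` is `λ_{s+1}(V)`). -/
def EkPerp [Fintype V] (G : SimpleGraph V) [DecidableRel G.Adj]
    (w : V → V → ℝ) (μ : V → ℝ) {m : ℕ} (lam : Fin m → ℝ) (k : ℕ) : Set (V → ℝ) :=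
  {u | u ∈ Hsp μ ∧ ∀ s : Fin m, (s : ℕ) < k → ∀ v ∈ eigSp G w μ (lam s),
    intV μ (fun x => u x * v x) = 0}

/-- Green's formula: `-Δ` is represented by the Dirichlet form. -/
theorem intV_mul_lapV [Fintype V] (G : SimpleGraph V) [DecidableRel G.Adj]
    (w : V → V → ℝ) (hws : ∀ x y, w x y = w y x) (μ : V → ℝ) (hμ : ∀ x, 0 < μ x)
    (u v : V → ℝ) :
    intV μ (fun x => u x * lapV G w μ v x) =
      -(1 / 2) * ∑ x, ∑ y, if G.Adj x y then w x y * ((u y - u x) * (v y - v x)) else 0 := by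
  have expand : intV μ (fun x => u x * lapV G w μ v x) =
      ∑ x, ∑ y, if G.Adj x y then w x y * (u x * (v y - v x)) else 0 := by
    refine Finset.sum_congr rfl fun x _ => ?_
    have cancel : ∀ S : ℝ, μ x * (u x * (1 / μ x * S)) = u x * S := fun S => by
      field_simp [(hμ x).ne']
    simp only [lapV, cancel, Finset.mul_sum]
    refine Finset.sum_congr rfl fun y _ => ?_
    split_ifs <;> ring
  have swap : (∑ x, ∑ y, if G.Adj x y then w x y * (u x * (v y - v x)) else 0) =
      ∑ x, ∑ y, if G.Adj x y then w x y * (u y * (v x - v y)) else 0 := by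
    rw [Finset.sum_comm]
    refine Finset.sum_congr rfl fun x _ => Finset.sum_congr rfl fun y _ => ?_
    simp only [G.adj_comm y x, hws y x]
  have regroup : (∑ x, ∑ y, if G.Adj x y then w x y * ((u y - u x) * (v y - v x)) else 0) =
      -((∑ x, ∑ y, if G.Adj x y then w x y * (u x * (v y - v x)) else 0) +
        ∑ x, ∑ y, if G.Adj x y then w x y * (u y * (v x - v y)) else 0) := by
    simp only [← Finset.sum_add_distrib, ← Finset.sum_neg_distrib]
    refine Finset.sum_congr rfl fun x _ => Finset.sum_congr rfl fun y _ => ?_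
    split_ifs <;> ring
  rw [expand, regroup, ← swap]
  ring

theorem intV_mul_lapV_comm [Fintype V] (G : SimpleGraph V) [DecidableRel G.Adj]
    (w : V → V → ℝ) (hws : ∀ x y, w x y = w y x) (μ : V → ℝ) (hμ : ∀ x, 0 < μ x)
    (u v : V → ℝ) :
    intV μ (fun x => u x * lapV G w μ v x) = intV μ (fun x => v x * lapV G w μ u x) := by
  rw [intV_mul_lapV G w hws μ hμ, intV_mul_lapV G w hws μ hμ]
  simp only [mul_comm]

theorem intV_gradSq [Fintype V] (G : SimpleGraph V) [DecidableRel G.Adj]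
    (w : V → V → ℝ) (hws : ∀ x y, w x y = w y x) (μ : V → ℝ) (hμ : ∀ x, 0 < μ x)
    (u : V → ℝ) :
    intV μ (gradSq G w μ u) = -intV μ (fun x => u x * lapV G w μ u x) := by
  rw [intV_mul_lapV G w hws μ hμ, neg_mul, neg_neg, Finset.mul_sum]
  refine Finset.sum_congr rfl fun x _ => ?_
  have cancel : ∀ S : ℝ, μ x * (1 / (2 * μ x) * S) = 1 / 2 * S := fun S => by
    field_simp [(hμ x).ne']
  simp only [gradSq, cancel, sq]

theorem intV_const_mul [Fintype V] (μ g : V → ℝ) (a : ℝ) :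
    intV μ (fun x => a * g x) = a * intV μ g := by
  simp only [intV, Finset.mul_sum, mul_left_comm]

theorem intV_sub [Fintype V] (μ f g : V → ℝ) :
    intV μ (fun x => f x - g x) = intV μ f - intV μ g := by
  simp only [intV, mul_sub, Finset.sum_sub_distrib]

theorem lapV_const_mul [Fintype V] (G : SimpleGraph V) [DecidableRel G.Adj]
    (w : V → V → ℝ) (μ u : V → ℝ) (a : ℝ) (x : V) :
    lapV G w μ (fun y => a * u y) x = a * lapV G w μ u x := by
  rw [lapV, lapV, mul_left_comm, Finset.mul_sum _ _ a]
  refine congrArg (1 / μ x * ·) (Finset.sum_congr rfl fun y _ => ?_)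
  split_ifs <;> ring

/-- Eigenfunctions of `-Δ` for distinct eigenvalues are orthogonal. -/
theorem intV_mul_eq_zero_of_eigenvalue_ne [Fintype V] (G : SimpleGraph V) [DecidableRel G.Adj]
    (w : V → V → ℝ) (hws : ∀ x y, w x y = w y x) (μ : V → ℝ) (hμ : ∀ x, 0 < μ x)
    {u v : V → ℝ} {a b : ℝ} (hab : a ≠ b) (hu : ∀ x, -(lapV G w μ u x) = a * u x)
    (hv : ∀ x, -(lapV G w μ v x) = b * v x) :
    intV μ (fun x => u x * v x) = 0 := by
  have key := intV_mul_lapV_comm G w hws μ hμ u v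
  have left : (fun x => u x * lapV G w μ v x) = fun x => -b * (u x * v x) :=
    funext fun x => by linear_combination -u x * hv x
  have right : (fun x => v x * lapV G w μ u x) = fun x => -a * (u x * v x) :=
    funext fun x => by linear_combination -v x * hu x
  rw [left, right, intV_const_mul, intV_const_mul] at key
  refine (mul_eq_zero.1 ?_).resolve_left (sub_ne_zero.2 hab)
  linear_combination key

theorem intV_eq_zero_of_eigenvalue_ne_zero [Fintype V] (G : SimpleGraph V) [DecidableRel G.Adj]
    (w : V → V → ℝ) (hws : ∀ x y, w x y = w y x) (μ : V → ℝ) (hμ : ∀ x, 0 < μ x)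
    {v : V → ℝ} {c : ℝ} (hc : c ≠ 0) (hv : ∀ x, -(lapV G w μ v x) = c * v x) :
    intV μ v = 0 := by
  have one : ∀ x, -(lapV G w μ (fun _ => 1) x) = 0 * 1 := by simp [lapV]
  simpa using intV_mul_eq_zero_of_eigenvalue_ne G w hws μ hμ hc hv one

/-- The quadratic part of `J_{c,β}` vanishes on the eigenspace of `c`. -/
theorem intV_gradSq_sub_eq_zero [Fintype V] (G : SimpleGraph V) [DecidableRel G.Adj]
    (w : V → V → ℝ) (hws : ∀ x y, w x y = w y x) (μ : V → ℝ) (hμ : ∀ x, 0 < μ x)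
    {v : V → ℝ} {c : ℝ} (hv : ∀ x, -(lapV G w μ v x) = c * v x) :
    intV μ (fun x => gradSq G w μ v x - c * v x ^ 2) = 0 := by
  have lap : (fun x => v x * lapV G w μ v x) = fun x => -c * v x ^ 2 :=
    funext fun x => by linear_combination -v x * hv x
  rw [intV_sub, intV_gradSq G w hws μ hμ, lap, intV_const_mul, intV_const_mul]
  ring

theorem exists_pos_of_intV_eq_zero [Fintype V] {μ v : V → ℝ} (hμ : ∀ x, 0 < μ x)
    (hv : v ≠ 0) (hint : intV μ v = 0) : ∃ x, 0 < v x := by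
  by_contra! hneg
  have term := (Finset.sum_eq_zero_iff_of_nonpos (f := fun x => μ x * v x) fun x _ =>
    mul_nonpos_of_nonneg_of_nonpos (hμ x).le (hneg x)).1 hint
  exact hv (funext fun x => (mul_eq_zero.1 (term x (Finset.mem_univ x))).resolve_left (hμ x).ne')

/-- The logarithmic term is bounded below by the contribution of a single point. -/
theorem log_mul_add_le_log_intV_exp [Fintype V] {μ h : V → ℝ} (hμ : ∀ x, 0 < μ x)
    (hh : ∀ x, 0 < h x) (u : V → ℝ) (x : V) :
    Real.log (μ x * h x) + u x ≤ Real.log (intV μ (fun y => h y * Real.exp (u y))) := by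
  have pos : 0 < μ x * h x := mul_pos (hμ x) (hh x)
  rw [← Real.log_exp (u x), ← Real.log_mul pos.ne' (Real.exp_pos _).ne', mul_assoc]
  refine Real.log_le_log (by rw [← mul_assoc]; exact mul_pos pos (Real.exp_pos _)) ?_
  exact Finset.single_le_sum (f := fun y => μ y * (h y * Real.exp (u y)))
    (fun y _ => (mul_pos (hμ y) (mul_pos (hh y) (Real.exp_pos _))).le) (Finset.mem_univ x)

theorem stmt7 [Fintype V] (G : SimpleGraph V) [DecidableRel G.Adj]
    (hG : G.Connected) (w : V → V → ℝ) (hws : ∀ x y, w x y = w y x)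
    (hwp : ∀ x y, G.Adj x y → 0 < w x y)
    (μ : V → ℝ) (hμ : ∀ x, 0 < μ x) (h : V → ℝ) (hh : ∀ x, 0 < h x)
    (m : ℕ) (lam : Fin m → ℝ) (hmono : StrictMono lam)
    (hrange : ∀ c : ℝ, c ∈ Set.range lam ↔
      (c ≠ 0 ∧ ∃ v : V → ℝ, v ≠ 0 ∧ ∀ x, -(lapV G w μ v x) = c * v x))
    (k : ℕ) (hk : k < m) (β : ℝ) (hβ : 0 < β) :
    (⨅ u ∈ EkPerp G w μ lam k, (Jab G w μ h (lam ⟨k, hk⟩) β u : EReal)) = ⊥ := by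
  obtain ⟨hc, v, hv0, hv⟩ := (hrange (lam ⟨k, hk⟩)).1 ⟨_, rfl⟩
  obtain ⟨x₀, hx₀⟩ := exists_pos_of_intV_eq_zero hμ hv0
    (intV_eq_zero_of_eigenvalue_ne_zero G w hws μ hμ hc hv)
  rw [EReal.eq_bot_iff_forall_lt]
  intro r
  obtain ⟨t, ht⟩ := exists_gt ((-r / β - Real.log (μ x₀ * h x₀)) / v x₀)
  have hu : ∀ x, -(lapV G w μ (fun y => t * v y) x) = lam ⟨k, hk⟩ * (t * v x) := fun x => by
    rw [lapV_const_mul]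
    linear_combination t * hv x
  have mem : (fun y => t * v y) ∈ EkPerp G w μ lam k :=
    ⟨intV_eq_zero_of_eigenvalue_ne_zero G w hws μ hμ hc hu, fun s hs f hf =>
      intV_mul_eq_zero_of_eigenvalue_ne G w hws μ hμ
        (hmono (show s < ⟨k, hk⟩ from hs)).ne' hu hf.2⟩
  refine (iInf₂_le _ mem).trans_lt (EReal.coe_lt_coe_iff.2 ?_)
  rw [Jab, intV_gradSq_sub_eq_zero G w hws μ hμ hu]
  have bound := log_mul_add_le_log_intV_exp hμ hh (fun y => t * v y) x₀
  rw [div_lt_iff₀ hx₀] at ht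
  have large := (div_lt_iff₀ hβ).1 ((sub_lt_iff_lt_add'.1 ht).trans_le bound)
  linarith
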